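/- Let α > 0, σ ∈ (0,1), c > −σ, and let N ≥ 1 and R ≥ 1 be fixed integers. For each integer M ≥ R, let Z_M be a random variable with Poisson distribution of mean Σ_{r=1}^{R} λ_r(M), where λ_r(M) := α · binom(M,r) · Γ(r−σ) Γ(c+σ+N+M−r) Γ(c+1) / (Γ(1−σ) Γ(c+σ) Γ(c+N+M)), and set ξ_r := (α/r!) · (Γ(r−σ)/Γ(1−σ)) · Γ(c+1)/Γ(c+σ). Then the law of (Z_M − (Σ_{r=1}^{R} ξ_r) M^σ)/M^{σ/2} converges weakly, as M → ∞, to the Gaussian distribution on ℝ with mean 0 and variance Σ_{r=1}^{R} ξ_r. -/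

import Mathlib

open Real MeasureTheory ProbabilityTheory Filter Finset

/-- `f = 1 + O(1/M)`. -/
def NearOne (f : ℕ → ℝ) : Prop :=
  (fun M : ℕ => f M - 1) =O[atTop] (fun M : ℕ => ((M : ℝ))⁻¹)

lemma NearOne.tendsto {f : ℕ → ℝ} (h : NearOne f) : Tendsto f atTop (nhds 1) := by
  have h1 : Tendsto (fun M : ℕ => f M - 1) atTop (nhds 0) :=
    Asymptotics.IsBigO.trans_tendsto h tendsto_inv_atTop_nhds_zero_nat
  simpa using h1.add_const 1

lemma NearOne.congr {f g : ℕ → ℝ} (h : NearOne f) (hfg : f =ᶠ[atTop] g) : NearOne g := by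
  refine Asymptotics.IsBigO.congr' h ?_ (EventuallyEq.refl _ _)
  filter_upwards [hfg] with M hM
  rw [hM]

lemma NearOne.one : NearOne (fun _ => 1) := by
  unfold NearOne
  simpa using Asymptotics.isBigO_zero _ _

lemma NearOne.mul {f g : ℕ → ℝ} (hf : NearOne f) (hg : NearOne g) :
    NearOne (fun M => f M * g M) := by
  have h1 : (fun M : ℕ => (f M - 1) * g M) =O[atTop] (fun M : ℕ => ((M : ℝ))⁻¹ * 1) :=
    Asymptotics.IsBigO.mul hf (hg.tendsto.isBigO_one ℝ)
  simp only [mul_one] at h1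
  have h2 := Asymptotics.IsBigO.add h1 hg
  refine h2.congr_left fun M => ?_
  ring

lemma NearOne.rpow {f : ℕ → ℝ} (hf : NearOne f) (p : ℝ) : NearOne (fun M => f M ^ p) := by
  have h := (Real.hasDerivAt_rpow_const (x := 1) (p := p) (Or.inl one_ne_zero)).isBigO_sub
  have h2 := (h.comp_tendsto hf.tendsto).trans (g := fun M => f M - 1) (by
    exact Asymptotics.isBigO_refl _ _)
  have h3 := h2.trans hf
  simpa [Function.comp_def, NearOne] using h3

lemma NearOne.div_self (a : ℝ) : NearOne (fun M : ℕ => ((M : ℝ) + a) / M) := by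
  have h : (fun M : ℕ => a * ((M : ℝ))⁻¹) =O[atTop] (fun M : ℕ => ((M : ℝ))⁻¹) :=
    Asymptotics.isBigO_const_mul_self _ _ _
  refine h.congr' ?_ (EventuallyEq.refl _ _)
  filter_upwards [eventually_gt_atTop 0] with M hM
  have : (M : ℝ) ≠ 0 := by positivity
  field_simp
  ring

lemma eventually_add_pos (a : ℝ) : ∀ᶠ M : ℕ in atTop, 0 < (M : ℝ) + a :=
  (tendsto_atTop_add_const_right _ a tendsto_natCast_atTop_atTop).eventually_gt_atTop 0

lemma NearOne.div_add (a b : ℝ) : NearOne (fun M : ℕ => ((M : ℝ) + a) / (M + b)) := by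
  refine ((NearOne.div_self a).mul ((NearOne.div_self b).rpow (-1))).congr ?_
  filter_upwards [eventually_gt_atTop 0, eventually_add_pos b] with M hM hb
  have : (M : ℝ) ≠ 0 := by positivity
  rw [Real.rpow_neg_one]
  field_simp

lemma NearOne.prod {ι : Type*} (s : Finset ι) (f : ι → ℕ → ℝ) (h : ∀ i ∈ s, NearOne (f i)) :
    NearOne (fun M => ∏ i ∈ s, f i M) := by
  classical
  induction s using Finset.induction_on with
  | empty => simpa using NearOne.one
  | insert a s ha ih =>
    simp only [Finset.prod_insert ha]
    exact (h a (by simp)).mul (ih fun i hi => h i (by simp [hi]))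

lemma NearOne.squeeze {f g h : ℕ → ℝ} (hf : NearOne f) (hh : NearOne h)
    (h1 : ∀ᶠ M in atTop, f M ≤ g M) (h2 : ∀ᶠ M in atTop, g M ≤ h M) : NearOne g := by
  have h3 := (Asymptotics.IsBigO.norm_left hf).add (Asymptotics.IsBigO.norm_left hh)
  refine Asymptotics.IsBigO.trans (Asymptotics.IsBigO.of_bound 1 ?_) h3
  filter_upwards [h1, h2] with M a b
  simp only [Real.norm_eq_abs, one_mul]
  rw [abs_of_nonneg (by positivity : 0 ≤ |f M - 1| + |h M - 1|), abs_le]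
  constructor
  · linarith [neg_abs_le (f M - 1), abs_nonneg (h M - 1)]
  · linarith [le_abs_self (h M - 1), abs_nonneg (f M - 1)]

lemma wendel_upper {x a : ℝ} (hx : 0 < x) (ha : 0 < a) (ha1 : a < 1) :
    Real.Gamma (x + a) ≤ Real.Gamma x * x ^ a := by
  have h := Real.Gamma_mul_add_mul_le_rpow_Gamma_mul_rpow_Gamma (s := x) (t := x + 1)
    (a := 1 - a) (b := a) hx (by linarith) (by linarith) ha (by ring)
  have hG := Real.Gamma_pos_of_pos hx
  rw [Real.Gamma_add_one hx.ne', Real.mul_rpow hx.le hG.le] at h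
  calc Real.Gamma (x + a) = Real.Gamma ((1 - a) * x + a * (x + 1)) := by congr 1; ring
    _ ≤ _ := h
    _ = (Real.Gamma x ^ (1 - a) * Real.Gamma x ^ a) * x ^ a := by ring
    _ = _ := by rw [← Real.rpow_add hG]; simp

lemma wendel_lower {x a : ℝ} (hx : 0 < x) (ha : 0 < a) (ha1 : a < 1) :
    Real.Gamma x * x ≤ Real.Gamma (x + a) * (x + a) ^ (1 - a) := by
  have h := wendel_upper (x := x + a) (a := 1 - a) (by linarith) (by linarith) (by linarith)
  rwa [show x + a + (1 - a) = x + 1 by ring, Real.Gamma_add_one hx.ne', mul_comm] at h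

lemma nearOne_gamma (b σ : ℝ) (h0 : 0 < σ) (h1 : σ < 1) :
    NearOne (fun M : ℕ => Real.Gamma ((M : ℝ) + b + σ) / (Real.Gamma (M + b) * (M : ℝ) ^ σ)) := by
  refine NearOne.squeeze
    (((NearOne.div_self b).rpow σ).mul ((NearOne.div_add b (b + σ)).rpow (1 - σ)))
    ((NearOne.div_self b).rpow σ) ?_ ?_
  · filter_upwards [eventually_gt_atTop 0, eventually_add_pos b] with M hM hb
    have hM' : (0 : ℝ) < M := by positivity
    have hl := wendel_lower hb h0 h1
    have hG := Real.Gamma_pos_of_pos hb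
    have hbs : (0 : ℝ) < M + b + σ := by linarith
    rw [← add_assoc, Real.div_rpow hb.le hM'.le, Real.div_rpow hb.le hbs.le]
    have e : ((M : ℝ) + b) ^ σ * ((M : ℝ) + b) ^ (1 - σ) = M + b := by
      rw [← Real.rpow_add hb]; simp
    have p1 := Real.rpow_pos_of_pos hM' σ
    have p2 := Real.rpow_pos_of_pos hbs (1 - σ)
    rw [div_mul_div_comm, e, div_le_div_iff₀ (by positivity) (by positivity)]
    nlinarith [mul_le_mul_of_nonneg_right hl p1.le]
  · filter_upwards [eventually_gt_atTop 0, eventually_add_pos b] with M hM hb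
    have hM' : (0 : ℝ) < M := by positivity
    have hl := wendel_upper hb h0 h1
    have hG := Real.Gamma_pos_of_pos hb
    rw [Real.div_rpow hb.le hM'.le]
    have p1 := Real.rpow_pos_of_pos hM' σ
    rw [div_le_div_iff₀ (by positivity) (by positivity)]
    nlinarith [mul_le_mul_of_nonneg_right hl p1.le]

lemma gamma_add_nat {y : ℝ} (hy : 0 < y) (r : ℕ) :
    Real.Gamma (y + r) = Real.Gamma y * ∏ j ∈ Finset.range r, (y + j) := by
  induction r with
  | zero => simp
  | succ r ih =>
    have : y + (r : ℝ) ≠ 0 := by positivity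
    rw [Finset.prod_range_succ, ← mul_assoc, ← ih]
    push_cast
    rw [← add_assoc, Real.Gamma_add_one this]
    ring

lemma choose_real {M r : ℕ} (h : r ≤ M) :
    (M.choose r : ℝ) = (∏ j ∈ Finset.range r, ((M : ℝ) - j)) / (r.factorial : ℝ) := by
  have h1 : (r.factorial : ℝ) * (M.choose r : ℝ) = ∏ j ∈ Finset.range r, ((M : ℝ) - j) := by
    rw [← Nat.cast_mul, ← Nat.descFactorial_eq_factorial_mul_choose,
      Nat.descFactorial_eq_prod_range, Nat.cast_prod]
    refine Finset.prod_congr rfl fun j hj => ?_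
    rw [Nat.cast_sub]
    have := Finset.mem_range.1 hj
    omega
  have : (r.factorial : ℝ) ≠ 0 := by positivity
  rw [← h1]; field_simp

/-- The correction factor. -/
noncomputable def corr (c σ : ℝ) (N r : ℕ) (M : ℕ) : ℝ :=
  Real.Gamma ((M : ℝ) + (c + N - r) + σ) / (Real.Gamma (M + (c + N - r)) * (M : ℝ) ^ σ) *
    ∏ j ∈ Finset.range r, (((M : ℝ) + (-(j : ℝ))) / (M + (c + N - r + j)))

lemma corr_nearOne (c σ : ℝ) (h0 : 0 < σ) (h1 : σ < 1) (N r : ℕ) : NearOne (corr c σ N r) :=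
  (nearOne_gamma _ σ h0 h1).mul (NearOne.prod _ _ fun _ _ => NearOne.div_add _ _)

lemma lam_eq (α σ c : ℝ) (hσ0 : 0 < σ) (hσ1 : σ < 1) (hc : -σ < c) (N r : ℕ) :
    ∀ᶠ M : ℕ in atTop,
      α * (M.choose r : ℝ) *
          (Real.Gamma ((r : ℝ) - σ) * Real.Gamma (c + σ + N + M - r) * Real.Gamma (c + 1)) /
          (Real.Gamma (1 - σ) * Real.Gamma (c + σ) * Real.Gamma (c + N + M)) =
      (α / (r.factorial : ℝ) * (Real.Gamma ((r : ℝ) - σ) / Real.Gamma (1 - σ)) *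
        (Real.Gamma (c + 1) / Real.Gamma (c + σ))) * (M : ℝ) ^ σ * corr c σ N r M := by
  filter_upwards [eventually_gt_atTop 0, eventually_ge_atTop r,
    eventually_add_pos (c + N - r)] with M hM hr hy
  have hM' : (0 : ℝ) < M := by positivity
  have e1 : c + N + M = (M + (c + N - r)) + (r : ℝ) := by ring
  have e2 : c + σ + N + M - r = (M : ℝ) + (c + N - r) + σ := by ring
  rw [e1, e2, gamma_add_nat hy, choose_real hr, corr, Finset.prod_div_distrib]
  simp only [← sub_eq_add_neg, ← add_assoc]
  have g1 := Real.Gamma_pos_of_pos hy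
  have g2 : 0 < Real.Gamma (1 - σ) := Real.Gamma_pos_of_pos (by linarith)
  have g3 : 0 < Real.Gamma (c + σ) := Real.Gamma_pos_of_pos (by linarith)
  have p1 := Real.rpow_pos_of_pos hM' σ
  have hP : 0 < ∏ j ∈ Finset.range r, ((M : ℝ) + (c + N - r) + j) :=
    Finset.prod_pos fun j _ => by positivity
  simp only [← add_assoc, ← sub_eq_add_neg, add_sub_assoc] at *
  field_simp

lemma charFun_poisson_affine (l : NNReal) (m b t : ℝ) :
    charFun (Measure.map (fun k : ℕ => ((k : ℝ) - m) / b) (poissonMeasure l)) t =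
      Complex.exp (l * (Complex.exp ((t / b : ℝ) * Complex.I) - 1)
        - (m * (t / b) : ℝ) * Complex.I) := by
  have e : (fun k : ℕ => ((k : ℝ) - m) / b) =
      (fun x : ℝ => b⁻¹ * x) ∘ (fun x : ℝ => x + (-m)) ∘ (Nat.cast : ℕ → ℝ) := by
    funext k; simp [div_eq_inv_mul, sub_eq_add_neg]
  rw [e, ← Measure.map_map (by fun_prop) (by fun_prop), ← Measure.map_map (by fun_prop)
    (by fun_prop), charFun_map_mul, charFun_map_add_const, charFun_map_cast_poissonMeasure,
    ← Complex.exp_add]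
  congr 1
  simp [div_eq_inv_mul]
  ring

lemma exponent_tendsto (L m b : ℕ → ℝ) (X t : ℝ) (hL : ∀ᶠ n in atTop, 0 ≤ L n)
    (hb : Tendsto b atTop atTop)
    (h1 : Tendsto (fun n => L n / b n ^ 2) atTop (nhds X))
    (h2 : Tendsto (fun n => (L n - m n) / b n) atTop (nhds 0)) :
    Tendsto (fun n => (L n : ℂ) * (Complex.exp ((t / b n : ℝ) * Complex.I) - 1)
        - (m n * (t / b n) : ℝ) * Complex.I) atTop (nhds (-(X * t ^ 2 / 2 : ℝ))) := by
  have hs : Tendsto (fun n => |t / b n|) atTop (nhds 0) := by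
    have := (hb.const_div_atTop t).abs
    simpa using this
  have hrem : Tendsto (fun n => (L n : ℂ) * (Complex.exp ((t / b n : ℝ) * Complex.I) -
      ∑ k ∈ Finset.range 3, ((t / b n : ℝ) * Complex.I) ^ k / (k.factorial : ℂ)))
      atTop (nhds 0) := by
    have hB : Tendsto (fun n => (L n / b n ^ 2) * t ^ 2 * (|t / b n| * Real.exp |t / b n|))
        atTop (nhds 0) := by
      have := (h1.mul_const (t ^ 2)).mul (hs.mul (Real.continuous_exp.tendsto 0 |>.comp hs))
      simpa using this
    refine squeeze_zero_norm' ?_ hB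
    filter_upwards [hL, hb.eventually_gt_atTop 0] with n hn hbn
    have := Complex.norm_exp_sub_sum_le_norm_mul_exp ((t / b n : ℝ) * Complex.I) 3
    rw [norm_mul, Complex.norm_real, Real.norm_of_nonneg hn]
    have e : ‖((t / b n : ℝ) : ℂ) * Complex.I‖ = |t / b n| := by
      rw [norm_mul, Complex.norm_I, mul_one, Complex.norm_real, Real.norm_eq_abs]
    rw [e] at this
    refine (mul_le_mul_of_nonneg_left this hn).trans (le_of_eq ?_)
    have e3 : |t / b n| ^ 3 = t ^ 2 / b n ^ 2 * |t / b n| := by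
      rw [pow_succ, sq_abs, div_pow]
    rw [e3]; ring
  have hmain : Tendsto (fun n => (((L n - m n) / b n * t : ℝ) : ℂ) * Complex.I
      - ((L n / b n ^ 2 * t ^ 2 / 2 : ℝ) : ℂ)) atTop
      (nhds (((0 * t : ℝ) : ℂ) * Complex.I - ((X * t ^ 2 / 2 : ℝ) : ℂ))) := by
    refine Tendsto.sub (Tendsto.mul_const _ ?_) ?_
    · exact (Complex.continuous_ofReal.tendsto _).comp (h2.mul_const t)
    · exact (Complex.continuous_ofReal.tendsto _).comp ((h1.mul_const _).div_const 2)
  have h := hrem.add hmain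
  have ee : (0 : ℂ) + (((0 * t : ℝ) : ℂ) * Complex.I - ((X * t ^ 2 / 2 : ℝ) : ℂ)) =
      -((X * t ^ 2 / 2 : ℝ) : ℂ) := by simp
  rw [ee] at h
  refine h.congr fun n => ?_
  simp only [Finset.sum_range_succ, Finset.sum_range_zero, mul_pow, Complex.I_sq]
  push_cast [Nat.factorial]
  ring

/-- CLT for the number of new variants appearing at most `R` times.  With
`λ_r(M) := α·C(M,r)·Γ(r−σ)Γ(c+σ+N+M−r)Γ(c+1)/(Γ(1−σ)Γ(c+σ)Γ(c+N+M))` and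
`ξ_r := (α/r!)·(Γ(r−σ)/Γ(1−σ))·Γ(c+1)/Γ(c+σ)`, if `Z_M ~ Poisson(∑_{r=1}^R λ_r(M))` then
the law of `(Z_M − (∑_{r=1}^R ξ_r) M^σ)/M^{σ/2}` converges weakly to the Gaussian
`N(0, ∑_{r=1}^R ξ_r)`. -/
theorem stmt10 (α σ c : ℝ) (hα : 0 < α) (hσ0 : 0 < σ) (hσ1 : σ < 1) (hc : -σ < c)
    (N R : ℕ) (hN : 1 ≤ N) (hR : 1 ≤ R)
    (μ : ℕ → ProbabilityMeasure ℝ)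
    (hμ : ∀ M : ℕ, R ≤ M →
      (μ M : Measure ℝ) =
        Measure.map
          (fun k : ℕ =>
            ((k : ℝ) -
                (∑ r ∈ Finset.Icc 1 R,
                    α / (r.factorial : ℝ) * (Real.Gamma ((r : ℝ) - σ) / Real.Gamma (1 - σ)) *
                      (Real.Gamma (c + 1) / Real.Gamma (c + σ))) * (M : ℝ) ^ σ) /
              (M : ℝ) ^ (σ / 2))
          (poissonMeasure
            (Real.toNNReal
              (∑ r ∈ Finset.Icc 1 R,
                α * (M.choose r : ℝ) *
                    (Real.Gamma ((r : ℝ) - σ) * Real.Gamma (c + σ + N + M - r) *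
                      Real.Gamma (c + 1)) /
                  (Real.Gamma (1 - σ) * Real.Gamma (c + σ) * Real.Gamma (c + N + M))))))
    (ν : ProbabilityMeasure ℝ)
    (hν : (ν : Measure ℝ) =
      gaussianReal 0
        (Real.toNNReal
          (∑ r ∈ Finset.Icc 1 R,
            α / (r.factorial : ℝ) * (Real.Gamma ((r : ℝ) - σ) / Real.Gamma (1 - σ)) *
              (Real.Gamma (c + 1) / Real.Gamma (c + σ))))) :
    Filter.Tendsto μ Filter.atTop (nhds ν) := by
  classical
  set ξ : ℕ → ℝ := fun r => α / (r.factorial : ℝ) *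
    (Real.Gamma ((r : ℝ) - σ) / Real.Gamma (1 - σ)) *
      (Real.Gamma (c + 1) / Real.Gamma (c + σ)) with hξ
  set lam : ℕ → ℕ → ℝ := fun M r => α * (M.choose r : ℝ) *
    (Real.Gamma ((r : ℝ) - σ) * Real.Gamma (c + σ + N + M - r) * Real.Gamma (c + 1)) /
      (Real.Gamma (1 - σ) * Real.Gamma (c + σ) * Real.Gamma (c + N + M)) with hlam
  have hξ0 : ∀ r ∈ Finset.Icc 1 R, 0 ≤ ξ r := by
    intro r hr
    have h1r : (1 : ℝ) ≤ r := by exact_mod_cast (Finset.mem_Icc.1 hr).1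
    have g1 : 0 < Real.Gamma ((r : ℝ) - σ) := Real.Gamma_pos_of_pos (by linarith)
    have g2 : 0 < Real.Gamma (1 - σ) := Real.Gamma_pos_of_pos (by linarith)
    have g3 : 0 < Real.Gamma (c + σ) := Real.Gamma_pos_of_pos (by linarith)
    have g4 : 0 < Real.Gamma (c + 1) := Real.Gamma_pos_of_pos (by linarith)
    simp only [hξ]
    positivity
  have hX0 : 0 ≤ ∑ r ∈ Finset.Icc 1 R, ξ r := Finset.sum_nonneg hξ0
  have hlamEq : ∀ᶠ M : ℕ in atTop, ∀ r ∈ Finset.Icc 1 R,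
      lam M r = ξ r * (M : ℝ) ^ σ * corr c σ N r M := by
    rw [Filter.eventually_all_finset]
    intro r _
    exact lam_eq α σ c hσ0 hσ1 hc N r
  have hcorr0 : ∀ᶠ M : ℕ in atTop, ∀ r ∈ Finset.Icc 1 R, 0 < corr c σ N r M := by
    rw [Filter.eventually_all_finset]
    intro r _
    exact (corr_nearOne c σ hσ0 hσ1 N r).tendsto.eventually (lt_mem_nhds one_pos)
  have hL0 : ∀ᶠ M : ℕ in atTop, 0 ≤ ∑ r ∈ Finset.Icc 1 R, lam M r := by
    filter_upwards [hlamEq, hcorr0] with M h1 h2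
    refine Finset.sum_nonneg fun r hr => ?_
    rw [h1 r hr]
    have := hξ0 r hr
    have := h2 r hr
    positivity
  have hb : Tendsto (fun M : ℕ => (M : ℝ) ^ (σ / 2)) atTop atTop :=
    (tendsto_rpow_atTop (by linarith)).comp tendsto_natCast_atTop_atTop
  have hsq : ∀ M : ℕ, ((M : ℝ) ^ (σ / 2)) ^ 2 = (M : ℝ) ^ σ := by
    intro M
    rw [← Real.rpow_natCast, ← Real.rpow_mul (Nat.cast_nonneg M)]
    congr 1
    push_cast
    ring
  have h1 : Tendsto (fun M : ℕ => (∑ r ∈ Finset.Icc 1 R, lam M r) / ((M : ℝ) ^ (σ / 2)) ^ 2)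
      atTop (nhds (∑ r ∈ Finset.Icc 1 R, ξ r)) := by
    have h : Tendsto (fun M : ℕ => ∑ r ∈ Finset.Icc 1 R, ξ r * corr c σ N r M) atTop
        (nhds (∑ r ∈ Finset.Icc 1 R, ξ r * 1)) :=
      tendsto_finsetSum _ fun r _ => (corr_nearOne c σ hσ0 hσ1 N r).tendsto.const_mul _
    simp only [mul_one] at h
    refine h.congr' ?_
    filter_upwards [hlamEq, eventually_gt_atTop 0] with M hM hM0
    have hM' : (0 : ℝ) < M := by positivity
    have p1 := Real.rpow_pos_of_pos hM' σ
    rw [hsq, Finset.sum_div]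
    refine Finset.sum_congr rfl fun r hr => ?_
    rw [hM r hr]
    field_simp
  have h2 : Tendsto (fun M : ℕ => ((∑ r ∈ Finset.Icc 1 R, lam M r) -
      (∑ r ∈ Finset.Icc 1 R, ξ r) * (M : ℝ) ^ σ) / (M : ℝ) ^ (σ / 2)) atTop (nhds 0) := by
    have hz : Tendsto (fun M : ℕ => (M : ℝ) ^ (σ / 2) * ((M : ℝ))⁻¹) atTop (nhds 0) := by
      have := (tendsto_rpow_neg_atTop (y := 1 - σ / 2) (by linarith)).comp
        (tendsto_natCast_atTop_atTop (R := ℝ))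
      refine this.congr' ?_
      filter_upwards [eventually_gt_atTop 0] with M hM0
      have hM' : (0 : ℝ) < M := by positivity
      rw [Function.comp_apply, ← Real.rpow_neg_one, ← Real.rpow_add hM']
      congr 1
      ring
    have h : Tendsto (fun M : ℕ => ∑ r ∈ Finset.Icc 1 R,
        ξ r * ((M : ℝ) ^ (σ / 2) * (corr c σ N r M - 1))) atTop
        (nhds (∑ r ∈ Finset.Icc 1 R, ξ r * 0)) := by
      refine tendsto_finsetSum _ fun r _ => Tendsto.const_mul _ ?_
      exact ((Asymptotics.isBigO_refl _ _).mul
        (corr_nearOne c σ hσ0 hσ1 N r)).trans_tendsto hz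
    simp only [mul_zero, Finset.sum_const_zero] at h
    refine h.congr' ?_
    filter_upwards [hlamEq, eventually_gt_atTop 0] with M hM hM0
    have hM' : (0 : ℝ) < M := by positivity
    have p1 := Real.rpow_pos_of_pos hM' (σ / 2)
    rw [Finset.sum_mul, ← Finset.sum_sub_distrib, Finset.sum_div]
    refine Finset.sum_congr rfl fun r hr => ?_
    rw [hM r hr, ← hsq]
    field_simp
  rw [ProbabilityMeasure.tendsto_iff_tendsto_charFun]
  intro t
  have h3 := (Complex.continuous_exp.tendsto _).comp
    (exponent_tendsto _ _ _ _ t hL0 hb h1 h2)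
  have e : charFun (ν : Measure ℝ) t =
      Complex.exp (-((((∑ r ∈ Finset.Icc 1 R, ξ r) * t ^ 2 / 2 : ℝ)) : ℂ)) := by
    rw [hν, charFun_gaussianReal]
    congr 1
    have hcoe : ((Real.toNNReal (∑ r ∈ Finset.Icc 1 R, ξ r) : NNReal) : ℝ) =
        ∑ r ∈ Finset.Icc 1 R, ξ r := Real.coe_toNNReal _ hX0
    rw [show (((Real.toNNReal (∑ r ∈ Finset.Icc 1 R, ξ r) : NNReal) : ℂ)) =
      ((((Real.toNNReal (∑ r ∈ Finset.Icc 1 R, ξ r) : NNReal) : ℝ)) : ℂ) from rfl, hcoe]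
    push_cast
    ring
  rw [e]
  refine h3.congr' ?_
  filter_upwards [hL0, eventually_ge_atTop R] with M hM hR'
  rw [hμ M hR', charFun_poisson_affine, Function.comp_apply]
  congr 3
  exact congrArg (fun x : ℝ => (x : ℂ)) (Real.coe_toNNReal _ hM).symm
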